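/- Let $(A,\mathfrak{m})$ be a noetherian local ring and $M$ a finitely presented $A$-module that is not free. Then there exists a local homomorphism $A \to B$ with $B$ an artinian local ring, an element $b \in B$ with $b \neq 0$ and $b^2 = 0$, and integers $n \geq 0$, $m \geq 1$, such that $M \otimes_A B \cong B^n \oplus (B/(b))^m$ as $B$-modules. -/

import Mathlib

open TensorProduct

/-- A subspace of a finite-dimensional vector space is cut out by the vanishing of some coordinates
in a suitable basis. -/
theorem Submodule.exists_basis_mem_iff_repr_eq_zero {K E : Type*} [Field K] [AddCommGroup E]
    [Module K E] [Module.Finite K E] (U : Submodule K E) :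
    ∃ (n m : ℕ) (e : Module.Basis (Fin n ⊕ Fin m) K E),
      ∀ x, x ∈ U ↔ ∀ j, e.repr x (Sum.inl j) = 0 := by
  obtain ⟨W, hW⟩ := exists_isCompl U
  let bW := Module.finBasis K W
  let bU := Module.finBasis K U
  refine ⟨_, _, (bW.prod bU).map (prodEquivOfIsCompl W U hW.symm), fun x => ?_⟩
  rw [← prodEquivOfIsCompl_symm_apply_fst_eq_zero _ _ hW.symm, ← bW.repr.map_eq_zero_iff,
    Finsupp.ext_iff]
  simp

namespace IsLocalRing

/-- Over a local ring, a submodule of a finite free module containing the maximal ideal times the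
module is cut out by requiring some coordinates in a suitable basis to be non-units. -/
theorem exists_basis_mem_iff_repr_mem_maximalIdeal {R F : Type*} [CommRing R] [IsLocalRing R]
    [AddCommGroup F] [Module R F] [Module.Free R F] [Module.Finite R F]
    (V : Submodule R F) (hV : maximalIdeal R • (⊤ : Submodule R F) ≤ V) :
    ∃ (n m : ℕ) (e : Module.Basis (Fin n ⊕ Fin m) R F),
      ∀ x, x ∈ V ↔ ∀ j, e.repr x (Sum.inl j) ∈ maximalIdeal R := by
  have : Module.FinitePresentation R F := Module.finitePresentation_of_projective R F
  let t : F →ₗ[R] ResidueField R ⊗[R] F := TensorProduct.mk R (ResidueField R) F 1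
  have ht : Function.Surjective t :=
    TensorProduct.mk_surjective R F (ResidueField R) Ideal.Quotient.mk_surjective
  have hker : LinearMap.ker t = maximalIdeal R • ⊤ := LinearMap.ker_tensorProductMk F
  let U : Submodule (ResidueField R) (ResidueField R ⊗[R] F) :=
    { (V.map t).toAddSubmonoid with
      smul_mem' := by
        intro c x hx
        obtain ⟨r, rfl⟩ := Ideal.Quotient.mk_surjective c
        exact (V.map t).smul_mem r hx }
  have hU (x : F) : t x ∈ U ↔ x ∈ V := by
    refine ⟨?_, fun hx => ⟨x, hx, rfl⟩⟩
    rintro ⟨v, hv, hvx⟩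
    have : x - v ∈ LinearMap.ker t := by rw [LinearMap.mem_ker, map_sub, hvx, sub_self]
    exact sub_add_cancel x v ▸ V.add_mem (hV (hker ▸ this)) hv
  obtain ⟨n, m, bk, hbk⟩ := U.exists_basis_mem_iff_repr_eq_zero
  choose v hv using fun i => ht (bk i)
  have hv' : t ∘ v = bk := funext hv
  obtain ⟨e, he⟩ := Module.exists_basis_of_basis_baseChange v
    (by rw [show (TensorProduct.mk R (ResidueField R) F 1 ∘ v) = bk from hv']
        exact bk.linearIndependent)
    (by rw [show (TensorProduct.mk R (ResidueField R) F 1 ∘ v) = bk from hv']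
        exact bk.span_eq)
    (Module.Flat.rTensor_preserves_injective_linearMap _ Subtype.val_injective)
  have hrepr (x : F) (i) : bk.repr (t x) i = residue R (e.repr x i) := by
    have hx : t x = ∑ i, residue R (e.repr x i) • bk i := by
      conv_lhs => rw [← e.sum_repr x]
      simp only [map_sum, map_smul, he, hv]
      rfl
    rw [hx, bk.repr_sum_self]
  refine ⟨n, m, e, fun x => ?_⟩
  simp_rw [← hU, hbk, hrepr, residue_eq_zero_iff]

/-- If `b` is a socle element of a local ring, the quotient of a finite free module by a
nonzero submodule of its `b`-multiples is a direct sum of copies of `R` and of `R ⧸ (b)`. -/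
theorem exists_equiv_prod_quotient_span_singleton {R F N : Type*} [CommRing R] [IsLocalRing R]
    [AddCommGroup F] [Module R F] [Module.Free R F] [Module.Finite R F]
    [AddCommGroup N] [Module R N] {b : R} (hmb : ∀ c ∈ maximalIdeal R, c * b = 0)
    (g : F →ₗ[R] N) (hg : Function.Surjective g) (hker : ∀ x, g x = 0 → ∃ y, x = b • y)
    (hne : LinearMap.ker g ≠ ⊥) :
    ∃ n m : ℕ, 1 ≤ m ∧
      Nonempty (N ≃ₗ[R] ((Fin n → R) × (Fin m → R ⧸ Ideal.span {b}))) := by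
  let V : Submodule R F := (LinearMap.ker g).comap (LinearMap.lsmul R F b)
  have hV (x : F) : x ∈ V ↔ g (b • x) = 0 := Iff.rfl
  obtain ⟨n, m, e, he⟩ := exists_basis_mem_iff_repr_mem_maximalIdeal V (by
    rw [Submodule.smul_le]
    intro c hc x _
    rw [hV, smul_smul, mul_comm, hmb c hc, zero_smul, map_zero])
  let Φ : F →ₗ[R] (Fin n → R) × (Fin m → R ⧸ Ideal.span {b}) :=
    (LinearMap.pi fun j => e.coord (Sum.inl j)).prod
      (LinearMap.pi fun j => (Ideal.span {b}).mkQ ∘ₗ e.coord (Sum.inr j))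
  have hΦ (x : F) : Φ x = 0 ↔ (∀ j, e.repr x (Sum.inl j) = 0) ∧
      ∀ j, b ∣ e.repr x (Sum.inr j) := by
    simp [Φ, Prod.ext_iff, funext_iff, Ideal.Quotient.eq_zero_iff_mem,
      Ideal.mem_span_singleton]
  have hsurj : Function.Surjective Φ := by
    rintro ⟨p, q⟩
    choose r hr using fun j => Ideal.Quotient.mk_surjective (q j)
    refine ⟨e.equivFun.symm (Sum.elim p r), ?_⟩
    have h (i) : e.repr (e.equivFun.symm (Sum.elim p r)) i = Sum.elim p r i :=
      congrFun (e.equivFun.apply_symm_apply (Sum.elim p r)) i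
    ext j
    · exact h (Sum.inl j)
    · refine Eq.trans ?_ (hr j)
      exact congrArg (Ideal.Quotient.mk (Ideal.span {b})) (h (Sum.inr j))
  have hkerΦ : LinearMap.ker g = LinearMap.ker Φ := by
    ext x
    rw [LinearMap.mem_ker, LinearMap.mem_ker, hΦ]
    constructor
    · intro hx
      obtain ⟨y, rfl⟩ := hker x hx
      have hy := (he y).1 hx
      simp only [map_smul, Finsupp.smul_apply, smul_eq_mul]
      exact ⟨fun j => by rw [mul_comm, hmb _ (hy j)], fun j => dvd_mul_right _ _⟩
    · rintro ⟨h0, h1⟩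
      choose c hc using h1
      let y := e.equivFun.symm (Sum.elim (0 : Fin n → R) c)
      have h (i) : e.repr y i = Sum.elim (0 : Fin n → R) c i :=
        congrFun (e.equivFun.apply_symm_apply (Sum.elim (0 : Fin n → R) c)) i
      have hxy : x = b • y := by
        refine e.ext_elem fun i => ?_
        rw [map_smul, Finsupp.smul_apply, h]
        rcases i with j | j
        · simp [h0]
        · simp [hc]
      rw [hxy, ← hV, he]
      intro j
      rw [h]
      exact zero_mem _
  refine ⟨n, m, ?_, ⟨(g.quotKerEquivOfSurjective hg).symm ≪≫ₗ
    Submodule.quotEquivOfEq _ _ hkerΦ ≪≫ₗ Φ.quotKerEquivOfSurjective hsurj⟩⟩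
  by_contra! hm
  obtain rfl : m = 0 := by omega
  refine hne (eq_bot_iff.2 fun x hx => ?_)
  rw [hkerΦ, LinearMap.mem_ker, hΦ] at hx
  refine e.ext_elem fun i => ?_
  rcases i with j | j
  · simpa using hx.1 j
  · exact j.elim0

/-- A noetherian local ring with a smallest nonzero ideal `I` is artinian, and `I` is generated by
an element killed by the maximal ideal. -/
theorem isArtinianRing_and_exists_span_singleton {R : Type*} [CommRing R] [IsLocalRing R]
    [IsNoetherianRing R] (I : Ideal R) (hI : I ≠ ⊥) (hmin : ∀ P : Ideal R, P ≠ ⊥ → I ≤ P) :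
    IsArtinianRing R ∧ ∃ b ∈ I, b ≠ 0 ∧ I ≤ Ideal.span {b} ∧
      ∀ c ∈ maximalIdeal R, c * b = 0 := by
  obtain ⟨b, hbI, hb⟩ := Submodule.exists_mem_ne_zero_of_ne_bot hI
  refine ⟨?_, b, hbI, hb, hmin _ (by simpa using hb), fun c hc => ?_⟩
  · rw [isArtinianRing_iff_isNilpotent_maximalIdeal]
    by_contra hnil
    refine hb ?_
    have hmem : b ∈ ⨅ i : ℕ, maximalIdeal R ^ i :=
      (Submodule.mem_iInf _).2 fun i => hmin _ (fun h => hnil ⟨i, h⟩) hbI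
    rwa [Ideal.iInf_pow_eq_bot_of_isLocalRing _ Ideal.IsPrime.ne_top', Ideal.mem_bot] at hmem
  · by_contra hcb
    obtain ⟨d, hd⟩ := Ideal.mem_span_singleton.1
      (hmin (Ideal.span {c * b}) (by simpa using hcb) hbI)
    have hu : IsUnit (1 - c * d) :=
      isUnit_one_sub_self_of_mem_nonunits _ (Ideal.mul_mem_right d _ hc)
    exact hb (hu.mul_right_eq_zero.1 (by linear_combination hd))

/-- A finite module over a local ring has a generating family all of whose relations have
coefficients in the maximal ideal. -/
theorem exists_span_eq_top_and_relations_mem_maximalIdeal (R M : Type*) [CommRing R]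
    [IsLocalRing R] [AddCommGroup M] [Module R M] [Module.Finite R M] :
    ∃ (s : ℕ) (v : Fin s → M), Submodule.span R (Set.range v) = ⊤ ∧
      ∀ a : Fin s → R, ∑ i, a i • v i = 0 → ∀ i, a i ∈ maximalIdeal R := by
  let w := Module.finBasis (ResidueField R) (ResidueField R ⊗[R] M)
  choose v hv using fun i =>
    TensorProduct.mk_surjective R M (ResidueField R) Ideal.Quotient.mk_surjective (w i)
  refine ⟨_, v, span_eq_top_of_tmul_eq_basis v w hv, fun a ha i => ?_⟩
  have h0 : ∑ i, residue R (a i) • w i = 0 := by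
    have := congrArg (TensorProduct.mk R (ResidueField R) M 1) ha
    simp only [map_sum, map_smul, hv, map_zero] at this
    exact this
  rw [← residue_eq_zero_iff]
  exact Fintype.linearIndependent_iff.1 w.linearIndependent _ h0 i

end IsLocalRing

/-- Let `(A, 𝔪)` be a noetherian local ring and `M` a finitely presented `A`-module that is
not free. Then there is a local homomorphism `A → B` with `B` artinian local, an element
`b ∈ B` with `b ≠ 0`, `b ^ 2 = 0`, and integers `n ≥ 0`, `m ≥ 1` with
`M ⊗[A] B ≅ B ^ n ⊕ (B ⧸ (b)) ^ m` as `B`-modules. -/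
theorem stmt1 (A : Type) [CommRing A] [IsLocalRing A] [IsNoetherianRing A]
    (M : Type) [AddCommGroup M] [Module A M] [Module.FinitePresentation A M]
    (hMfree : ¬ Module.Free A M) :
    ∃ (B : Type) (_ : CommRing B) (_ : IsLocalRing B) (_ : Algebra A B),
      IsArtinianRing B ∧
      IsLocalHom (algebraMap A B) ∧
      ∃ b : B, b ≠ 0 ∧ b ^ 2 = 0 ∧
        ∃ n m : ℕ, 1 ≤ m ∧
          Nonempty ((B ⊗[A] M) ≃ₗ[B]
            ((Fin n → B) × (Fin m → B ⧸ Ideal.span {b}))) := by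
  obtain ⟨s, v, hv, hrel⟩ :=
    IsLocalRing.exists_span_eq_top_and_relations_mem_maximalIdeal A M
  let I : Ideal A := Ideal.span {c | ∃ a : Fin s → A, ∑ i, a i • v i = 0 ∧ ∃ i, a i = c}
  have hImem {a : Fin s → A} (ha : ∑ i, a i • v i = 0) (i : Fin s) : a i ∈ I :=
    Ideal.subset_span ⟨a, ha, i, rfl⟩
  have hIm : I ≤ IsLocalRing.maximalIdeal A := by
    refine Ideal.span_le.2 ?_
    rintro _ ⟨a, ha, i, rfl⟩
    exact hrel a ha i
  have hI : ¬ I ≤ ⊥ := by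
    intro h
    refine hMfree (Module.Free.of_basis (Module.Basis.mk (v := v) ?_ hv.ge))
    exact Fintype.linearIndependent_iff.2 fun a ha i => h (hImem ha i)
  obtain ⟨J, hJ, hJmax⟩ := set_has_maximal_iff_noetherian.2
    (inferInstance : IsNoetherian A A) {J : Ideal A | ¬ I ≤ J} ⟨⊥, hI⟩
  have : Nontrivial (A ⧸ J) := Ideal.Quotient.nontrivial_iff.2 fun h => hJ (h ▸ le_top)
  have hsurj : Function.Surjective (Ideal.Quotient.mk J) := Ideal.Quotient.mk_surjective
  have hloc : IsLocalRing (A ⧸ J) := .of_surjective' _ hsurj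
  have hlocHom : IsLocalHom (Ideal.Quotient.mk J) := .of_surjective _ hsurj
  let I' : Ideal (A ⧸ J) := I.map (Ideal.Quotient.mk J)
  have hI' : I' ≠ ⊥ := by
    rw [Ne, Ideal.map_eq_bot_iff_le_ker, Ideal.mk_ker]
    exact hJ
  have hI'm : I' ≤ IsLocalRing.maximalIdeal (A ⧸ J) :=
    Ideal.map_le_iff_le_comap.2 fun x hx => by
      rw [Ideal.mem_comap, IsLocalRing.mem_maximalIdeal, map_mem_nonunits_iff]
      exact hIm hx
  have hmin (P : Ideal (A ⧸ J)) (hP : P ≠ ⊥) : I' ≤ P := by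
    rw [Ideal.map_le_iff_le_comap]
    by_contra h
    refine hJmax _ h (lt_of_le_of_ne (fun x hx => ?_) fun hJP => hP ?_)
    · rw [Ideal.mem_comap, Ideal.Quotient.eq_zero_iff_mem.2 hx]
      exact zero_mem _
    · rw [← Ideal.map_comap_of_surjective _ hsurj P, ← hJP, Ideal.map_quotient_self]
  obtain ⟨hart, b, hbI, hb, hIb, hmb⟩ :=
    IsLocalRing.isArtinianRing_and_exists_span_singleton I' hI' hmin
  refine ⟨A ⧸ J, inferInstance, hloc, inferInstance, hart, hlocHom, b, hb, ?_, ?_⟩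
  · rw [sq]
    exact hmb b (hI'm hbI)
  let g : (Fin s → A ⧸ J) →ₗ[A ⧸ J] (A ⧸ J) ⊗[A] M :=
    Fintype.linearCombination (A ⧸ J) fun i => (1 : A ⧸ J) ⊗ₜ[A] v i
  have hg (a : Fin s → A) : g (fun i => Ideal.Quotient.mk J (a i)) =
      TensorProduct.mk A (A ⧸ J) M 1 (∑ i, a i • v i) := by
    simp only [g, Fintype.linearCombination_apply, map_sum, map_smul]
    rfl
  refine IsLocalRing.exists_equiv_prod_quotient_span_singleton hmb g ?_ ?_ ?_
  · intro y
    obtain ⟨x, rfl⟩ := TensorProduct.mk_surjective A M (A ⧸ J) hsurj y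
    obtain ⟨a, rfl⟩ := (Submodule.mem_span_range_iff_exists_fun A).1
      (hv ▸ Submodule.mem_top : x ∈ Submodule.span A (Set.range v))
    exact ⟨_, hg a⟩
  · intro x hx
    choose a ha using fun i => hsurj (x i)
    obtain rfl : (fun i => Ideal.Quotient.mk J (a i)) = x := funext ha
    rw [hg, ← LinearMap.mem_ker, LinearMap.ker_tensorProductMk, ← hv,
      Submodule.mem_ideal_smul_span_iff_exists_sum] at hx
    obtain ⟨c, hcJ, hc⟩ := hx
    rw [Finsupp.sum_fintype _ _ (by simp)] at hc
    have hac : ∑ i, (a i - c i) • v i = 0 := by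
      simp only [sub_smul, Finset.sum_sub_distrib, hc, sub_self]
    have hdvd (i : Fin s) : b ∣ Ideal.Quotient.mk J (a i) := by
      have h := hIb (Ideal.mem_map_of_mem (Ideal.Quotient.mk J) (hImem hac i))
      rwa [map_sub, Ideal.Quotient.eq_zero_iff_mem.2 (hcJ i), sub_zero,
        Ideal.mem_span_singleton] at h
    choose y hy using hdvd
    exact ⟨y, funext hy⟩
  · intro hbot
    refine hJ (Ideal.span_le.2 ?_)
    rintro _ ⟨a, ha, i, rfl⟩
    have h : (fun i => Ideal.Quotient.mk J (a i)) ∈ LinearMap.ker g := by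
      rw [LinearMap.mem_ker, hg, ha, map_zero]
    rw [hbot, Submodule.mem_bot] at h
    exact Ideal.Quotient.eq_zero_iff_mem.1 (congrFun h i)
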